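/- If v and w are two operation sequences that produce the same permutation and have the same type, then for each position j, the item moved by the j-th letter of v equals the item moved by the j-th letter of w. -/

import Mathlib

/-!
Two stacks in parallel: operation sequences over the alphabet {I1, I2, O1, O2}.
-/

inductive Op : Type
  | I1 | I2 | O1 | O2
  deriving DecidableEq

/-- Machine state: (next unread input item, stack 1, stack 2, output so far). -/
abbrev MState := ℕ × List ℕ × List ℕ × List ℕ

/-- One step of the two-stack machine. -/
def mstep : MState → Op → MState
  | (k, s1, s2, out), Op.I1 => (k + 1, k :: s1, s2, out)
  | (k, s1, s2, out), Op.I2 => (k + 1, s1, k :: s2, out)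
  | (k, s1, s2, out), Op.O1 => (k, s1.tail, s2, out ++ [s1.headI])
  | (k, s1, s2, out), Op.O2 => (k, s1, s2.tail, out ++ [s2.headI])

/-- Run a word on the two-stack machine, starting with input item 1. -/
def mrun (w : List Op) : MState := w.foldl mstep (1, [], [], [])

/-- The output word (the permutation produced, as a list). -/
def output (w : List Op) : List ℕ := (mrun w).2.2.2

def h1 : Op → ℤ
  | Op.I1 => 1
  | Op.O1 => -1
  | _ => 0

def h2 : Op → ℤ
  | Op.I2 => 1
  | Op.O2 => -1
  | _ => 0

/-- `w` is an operation sequence: each projection on `{Ii, Oi}` is a Dyck word. -/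
def IsOpSeq (w : List Op) : Prop :=
  (w.map h1).sum = 0 ∧ (w.map h2).sum = 0 ∧
    ∀ p ∈ w.inits, 0 ≤ (p.map h1).sum ∧ 0 ≤ (p.map h2).sum

/-- `w` outputs eagerly: it contains neither `I1 O2` nor `I2 O1` as a factor. -/
def Eager (w : List Op) : Prop :=
  ¬ [Op.I1, Op.O2] <:+: w ∧ ¬ [Op.I2, Op.O1] <:+: w

/-- `true` for input letters `I1`, `I2`; `false` for output letters. -/
def isInput : Op → Bool
  | Op.I1 => true
  | Op.I2 => true
  | _ => false

/-- The item moved by a letter performed from a given machine state: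
the next unread input item for an input letter, the top of the relevant
stack for an output letter. -/
def moveOf : MState → Op → ℕ
  | (k, _, _, _), Op.I1 => k
  | (k, _, _, _), Op.I2 => k
  | (_, s1, _, _), Op.O1 => s1.headI
  | (_, _, s2, _), Op.O2 => s2.headI

/-- The item moved by the letter of `w` at (0-based) position `j`. -/
def movedAt (w : List Op) (j : ℕ) : ℕ :=
  moveOf (mrun (w.take j)) (w.getD j Op.I1)

theorem mstep_fst (s : MState) (a : Op) :
    (mstep s a).1 = if isInput a then s.1 + 1 else s.1 := by
  obtain ⟨k, s1, s2, out⟩ := s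
  cases a <;> rfl

theorem mstep_output (s : MState) (a : Op) :
    (mstep s a).2.2.2 = s.2.2.2 ++ if isInput a then [] else [moveOf s a] := by
  obtain ⟨k, s1, s2, out⟩ := s
  cases a <;> simp [mstep, isInput, moveOf]

theorem moveOf_of_isInput (s : MState) {a : Op} (ha : isInput a) : moveOf s a = s.1 := by
  obtain ⟨k, s1, s2, out⟩ := s
  cases a <;> simp_all [isInput, moveOf]

theorem output_prefix_foldl_mstep (w : List Op) (s : MState) :
    s.2.2.2 <+: (w.foldl mstep s).2.2.2 := by
  induction w generalizing s with
  | nil => exact List.prefix_rfl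
  | cons a w ih =>
    refine List.IsPrefix.trans ?_ (ih (mstep s a))
    rw [mstep_output]
    exact List.prefix_append _ _

/-- Runs of the same type from two states that agree on the next input item and on the length of
the output so far move the same items, provided that their final outputs agree. -/
theorem moveOf_foldl_eq (v w : List Op) (s t : MState) (hk : s.1 = t.1)
    (hlen : s.2.2.2.length = t.2.2.2.length)
    (hout : (v.foldl mstep s).2.2.2 = (w.foldl mstep t).2.2.2)
    (htype : v.map isInput = w.map isInput) (j : ℕ) (hj : j < v.length) :
    moveOf ((v.take j).foldl mstep s) (v.getD j Op.I1) =
      moveOf ((w.take j).foldl mstep t) (w.getD j Op.I1) := by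
  induction v generalizing w s t j with
  | nil => simp at hj
  | cons a v ih =>
    cases w with
    | nil => simp at htype
    | cons b w =>
      simp only [List.map_cons, List.cons.injEq] at htype
      obtain ⟨hab, htype⟩ := htype
      simp only [List.foldl_cons] at hout
      have hlen' : (mstep s a).2.2.2.length = (mstep t b).2.2.2.length := by
        rw [mstep_output, mstep_output, hab]
        cases isInput b <;> simp [hlen]
      cases j with
      | zero =>
        change moveOf s a = moveOf t b
        have hstep : (mstep s a).2.2.2 = (mstep t b).2.2.2 :=
          (List.prefix_of_prefix_length_le (output_prefix_foldl_mstep v _)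
            (hout ▸ output_prefix_foldl_mstep w _) hlen'.le).eq_of_length hlen'
        by_cases hb : isInput b
        · rw [moveOf_of_isInput s (hab.trans hb), moveOf_of_isInput t hb, hk]
        · rw [mstep_output, mstep_output, hab, if_neg hb, if_neg hb] at hstep
          simpa using (List.append_inj hstep hlen).2
      | succ j =>
        exact ih w (mstep s a) (mstep t b) (by rw [mstep_fst, mstep_fst, hab, hk]) hlen' hout htype
          j (by simpa using hj)

/-- If `v` and `w` are two operation sequences that produce the same permutation
and have the same type, then at each position they move the same item. -/
theorem same_type_same_moves (v w : List Op) (hv : IsOpSeq v) (hw : IsOpSeq w)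
    (hout : output v = output w) (htype : v.map isInput = w.map isInput) :
    ∀ j, j < v.length → movedAt v j = movedAt w j := by
  intro j hj
  exact moveOf_foldl_eq v w _ _ rfl rfl hout htype j hj
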